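/- arXiv:2307.12454 — 2 statements merged into one kernel-verified Lean document; each statement's English description precedes it below -/
import Mathlib

section
/- Classification of the signed digit representations of 0 (Section 7): for a sequence d : ℕ → ℤ with d n ∈ {-1, 0, 1} for all n, one has ∑' n, (d n : ℝ) / 2^(n+1) = 0 if and only if either (i) d n = 0 for all n, or (ii) there exists k such that d n = 0 for all n < k, d k = 1, and d n = -1 for all n > k, or (iii) there exists k such that d n = 0 for all n < k, d k = -1, and d n = 1 for all n > k. -/
theorem summable_signed_digits {d : ℕ → ℤ} (hd : ∀ n, |d n| ≤ 1) :
    Summable fun n : ℕ => (d n : ℝ) / 2 ^ (n + 1) := by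
  refine Summable.of_norm_bounded summable_geometric_two fun n => ?_
  have h : |(d n : ℝ)| ≤ 1 := by exact_mod_cast hd n
  rw [Real.norm_eq_abs, abs_div, abs_of_pos (by positivity : (0 : ℝ) < 2 ^ (n + 1)),
    one_div_pow]
  gcongr <;> norm_num

theorem hasSum_one_div_two_pow_tail (k : ℕ) :
    HasSum (fun n : ℕ => (1 : ℝ) / 2 ^ (n + k + 1)) (1 / 2 ^ k) := by
  convert hasSum_geometric_two' ((1 : ℝ) / 2 ^ k) using 2 with n
  rw [pow_succ, pow_add]
  field_simp

/-- A signed digit sequence whose first nonzero digit is `1` represents zero exactly when all the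
later digits are `-1`. -/
theorem tsum_signed_digits_eq_zero_iff_of_leading_one {d : ℕ → ℤ} (hd : ∀ n, |d n| ≤ 1) {k : ℕ}
    (h_zero : ∀ n < k, d n = 0) (h_one : d k = 1) :
    (∑' n : ℕ, (d n : ℝ) / 2 ^ (n + 1)) = 0 ↔ ∀ n > k, d n = -1 := by
  have hs := summable_signed_digits hd
  have h_head : ∑ n ∈ Finset.range (k + 1), (d n : ℝ) / 2 ^ (n + 1) = 1 / 2 ^ (k + 1) := by
    rw [Finset.sum_range_succ, Finset.sum_eq_zero fun n hn => by
      simp [h_zero n (Finset.mem_range.mp hn)], h_one]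
    simp
  have h_sum : HasSum (fun n : ℕ => ((d (n + (k + 1)) : ℝ) + 1) / 2 ^ (n + (k + 1) + 1))
      (∑' n : ℕ, (d n : ℝ) / 2 ^ (n + 1)) := by
    rw [← hs.sum_add_tsum_nat_add (k + 1), h_head, add_comm (1 / _)]
    simpa only [add_div] using
      ((summable_nat_add_iff (k + 1)).mpr hs).hasSum.add (hasSum_one_div_two_pow_tail (k + 1))
  have h_nonneg : ∀ n : ℕ, 0 ≤ ((d (n + (k + 1)) : ℝ) + 1) / 2 ^ (n + (k + 1) + 1) := fun n => by
    have h : (-1 : ℝ) ≤ d (n + (k + 1)) := by exact_mod_cast (abs_le.mp (hd _)).1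
    have h' : (0 : ℝ) ≤ d (n + (k + 1)) + 1 := by linarith
    positivity
  constructor
  · intro h n hn
    rw [h, hasSum_zero_iff_of_nonneg h_nonneg] at h_sum
    obtain ⟨m, rfl⟩ := Nat.exists_eq_add_of_le' (Nat.succ_le_of_lt hn)
    have hm := congrFun h_sum m
    simp only [Pi.zero_apply, div_eq_zero_iff, pow_eq_zero_iff', OfNat.ofNat_ne_zero, false_and,
      or_false] at hm
    have hm' : d (m + (k + 1)) + 1 = 0 := by exact_mod_cast hm
    exact eq_neg_of_add_eq_zero_left hm'
  · intro h
    rw [← h_sum.tsum_eq]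
    simp [fun n => h (n + (k + 1)) (by omega)]

theorem signed_digit_representations_of_zero (d : ℕ → ℤ)
    (hd : ∀ n, d n ∈ ({-1, 0, 1} : Set ℤ)) :
    (∑' n : ℕ, (d n : ℝ) / 2 ^ (n + 1)) = 0 ↔
      (∀ n, d n = 0) ∨
      (∃ k, (∀ n < k, d n = 0) ∧ d k = 1 ∧ ∀ n > k, d n = -1) ∨
      (∃ k, (∀ n < k, d n = 0) ∧ d k = -1 ∧ ∀ n > k, d n = 1) := by
  have hd_abs : ∀ n, |d n| ≤ 1 := fun n => by
    rcases hd n with h | h | (h : d n = 1) <;> simp [h]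
  have h_leading_neg_one : ∀ k, (∀ n < k, d n = 0) → d k = -1 →
      ((∑' n : ℕ, (d n : ℝ) / 2 ^ (n + 1)) = 0 ↔ ∀ n > k, d n = 1) := fun k h_zero h_neg => by
    have h := tsum_signed_digits_eq_zero_iff_of_leading_one (d := fun n => -d n) (k := k)
      (by simpa using hd_abs) (by simpa using h_zero) (by simp [h_neg])
    simpa [neg_div, tsum_neg] using h
  constructor
  · intro h
    by_cases h_all : ∀ n, d n = 0
    · exact Or.inl h_all
    push Not at h_all
    classical
    have h_zero : ∀ n < Nat.find h_all, d n = 0 := fun n hn => not_not.mp (Nat.find_min h_all hn)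
    rcases hd (Nat.find h_all) with hk | hk | hk
    · exact Or.inr (Or.inr ⟨_, h_zero, hk, (h_leading_neg_one _ h_zero hk).mp h⟩)
    · exact absurd hk (Nat.find_spec h_all)
    · exact Or.inr (Or.inl ⟨_, h_zero, hk,
        (tsum_signed_digits_eq_zero_iff_of_leading_one hd_abs h_zero hk).mp h⟩)
  · rintro (h | ⟨k, h_zero, hk, h⟩ | ⟨k, h_zero, hk, h⟩)
    · simp [h]
    · exact (tsum_signed_digits_eq_zero_iff_of_leading_one hd_abs h_zero hk).mpr h
    · exact (h_leading_neg_one k h_zero hk).mpr h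
end

section
/- Classification of the total infinite Gray codes of 0 (Section 7): a sequence p : ℕ → ℤ is an infinite Gray code of 0 if and only if (p 0 = 1 ∨ p 0 = -1), p 1 = 1, and p i = -1 for all i ≥ 2. In particular, 0 has exactly two total infinite Gray codes, 1:1:(-1)^ω and (-1):1:(-1)^ω. -/
noncomputable def tent (x : ℝ) : ℝ := 1 - 2 * |x|

def IsGrayCode (p : ℕ → ℤ) (x : ℝ) : Prop :=
  |x| ≤ 1 ∧ (∀ i, p i ∈ ({-1, 1} : Set ℤ)) ∧
    ∀ i, tent^[i] x ≠ 0 →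
      (0 < tent^[i] x → p i = 1) ∧ (tent^[i] x < 0 → p i = -1)

theorem tent_zero : tent 0 = 1 := by norm_num [tent]

theorem tent_iterate_zero_add_two (n : ℕ) : tent^[n + 2] 0 = -1 := by
  induction n with
  | zero => norm_num [tent]
  | succ n ih =>
    rw [show n + 1 + 2 = (n + 2) + 1 by omega, Function.iterate_succ_apply', ih]
    norm_num [tent]

theorem gray_codes_of_zero (p : ℕ → ℤ) :
    IsGrayCode p 0 ↔
      (p 0 = 1 ∨ p 0 = -1) ∧ p 1 = 1 ∧ ∀ i, 2 ≤ i → p i = -1 := by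
  constructor
  · rintro ⟨-, hmem, hsign⟩
    refine ⟨(hmem 0).symm, ?_, fun i hi => ?_⟩
    · have h := hsign 1
      rw [Function.iterate_one, tent_zero] at h
      exact (h one_ne_zero).1 one_pos
    · obtain ⟨n, rfl⟩ := Nat.exists_eq_add_of_le' hi
      have h := hsign (n + 2)
      rw [tent_iterate_zero_add_two] at h
      exact (h (by norm_num)).2 (by norm_num)
  · rintro ⟨h0, h1, h2⟩
    refine ⟨by simp, fun i => ?_, fun i => ?_⟩
    · match i with
      | 0 => exact h0.symm
      | 1 => exact Or.inr h1
      | n + 2 => exact Or.inl (h2 _ (by omega))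
    · match i with
      | 0 => simp
      | 1 =>
        rw [Function.iterate_one, tent_zero]
        exact fun _ => ⟨fun _ => h1, fun h => absurd h (by norm_num)⟩
      | n + 2 =>
        rw [tent_iterate_zero_add_two]
        exact fun _ => ⟨fun h => absurd h (by norm_num), fun _ => h2 _ (by omega)⟩
end
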